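/- Let Φ={φ_i}_{i∈Λ} be an analytic IFS on I=[0,1] with 0<|φ_i'(x)|<1 for all i∈Λ and x∈I, whose maps have no common fixed point, let p be a positive probability vector and μ the associated self-conformal measure. For every 0<ε<1 and integer k≥1 there exists ε₀=ε₀(ε,k)>0 such that for all m≥M(ε,k)≥1 and n≥N(ε,k,m)≥1 the following holds: let ν be a compactly supported Borel probability measure on P_k with ‖q‖_2 ≤ ε^{-1} for all q∈supp(ν) and (1/n)H(ν, D_n) ≥ ε; let ψ:I→I be C¹ with ε ≤ |ψ'(x)| ≤ ε^{-1} for all x∈I, and set θ:=ψμ. Then ∫ ℙ_{1≤i≤n}{ (1/m)H( (ν_{q,i}).x, D_{i+m} ) > ε₀ } dθ(x) > ε₀, where the inner probability is over i uniform in {1,…,n} and q distributed according to ν. -/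

import Mathlib

open MeasureTheory Filter Set Metric Topology

noncomputable section

/-- The unit interval `I = [0,1]`. -/
def unitI : Set ℝ := Set.Icc 0 1

/-- For a word `u = i₁…iₙ`, `compWord φ u = φ_{i₁} ∘ … ∘ φ_{iₙ}`. -/
def compWord {Λ : Type*} (φ : Λ → ℝ → ℝ) : List Λ → ℝ → ℝ
  | [] => id
  | i :: u => φ i ∘ compWord φ u

/-- `μ` is exact dimensional with dimension `d`. -/
def ExactDimWith (μ : Measure ℝ) (d : ℝ) : Prop :=
  ∀ᵐ x ∂μ, Tendsto (fun δ : ℝ =>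
      Real.log (μ (Metric.closedBall x δ)).toReal / Real.log δ)
    (nhdsWithin 0 (Set.Ioi 0)) (nhds d)

/-- The level-`n` dyadic interval `[m/2^n, (m+1)/2^n)`. -/
def dyadIco (n : ℕ) (m : ℤ) : Set ℝ :=
  Set.Ico ((m : ℝ) / 2 ^ n) (((m : ℝ) + 1) / 2 ^ n)

/-- Entropy of a measure on `ℝ` with respect to the level-`n` dyadic partition
(logarithms in base 2). -/
def ent1 (n : ℕ) (θ : Measure ℝ) : ℝ :=
  -∑' m : ℤ, (θ (dyadIco n m)).toReal * Real.logb 2 (θ (dyadIco n m)).toReal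

/-- The level-`n` dyadic cell containing `x`. -/
def dcell (n : ℕ) (x : ℝ) : Set ℝ := dyadIco n ⌊x * 2 ^ n⌋

/-- The level-`n` component `θ_{x,n}`: `θ` conditioned on the dyadic cell of `x`. -/
def dcomp (θ : Measure ℝ) (x : ℝ) (n : ℕ) : Measure ℝ :=
  (θ (dcell n x))⁻¹ • θ.restrict (dcell n x)

/-- The space `P_k` of polynomials of degree at most `k`, identified with `ℝ^{k+1}`
via coefficients; `polyEval k a` is the corresponding polynomial function. -/
def polyEval (k : ℕ) (a : EuclideanSpace ℝ (Fin (k + 1))) (x : ℝ) : ℝ :=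
  ∑ j : Fin (k + 1), a j * x ^ (j : ℕ)

/-- The level-`n` dyadic cell of `ℝ^d` indexed by `m : Fin d → ℤ`. -/
def vcell (d n : ℕ) (m : Fin d → ℤ) : Set (EuclideanSpace ℝ (Fin d)) :=
  {x | ∀ j, x j ∈ Set.Ico ((m j : ℝ) / 2 ^ n) (((m j : ℝ) + 1) / 2 ^ n)}

/-- Entropy of a measure on `ℝ^d ≃ P_{d-1}` with respect to the level-`n` dyadic
partition (logarithms in base 2). -/
def entV (d n : ℕ) (θ : Measure (EuclideanSpace ℝ (Fin d))) : ℝ :=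
  -∑' m : Fin d → ℤ,
    (θ (vcell d n m)).toReal * Real.logb 2 (θ (vcell d n m)).toReal

/-- The level-`n` component `ν_{q,n}` of a measure on `ℝ^d`. -/
def vcomp {d : ℕ} (ν : Measure (EuclideanSpace ℝ (Fin d)))
    (q : EuclideanSpace ℝ (Fin d)) (n : ℕ) : Measure (EuclideanSpace ℝ (Fin d)) :=
  (ν (vcell d n fun j => ⌊q j * 2 ^ n⌋))⁻¹ • ν.restrict (vcell d n fun j => ⌊q j * 2 ^ n⌋)

/-- The topological support of a measure. -/
def msupp {X : Type*} [TopologicalSpace X] [MeasurableSpace X] (θ : Measure X) : Set X :=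
  {x | ∀ U : Set X, IsOpen U → x ∈ U → θ U ≠ 0}

namespace DiscreteEntropy

lemma negMulLog_le_cross {w v : ℝ} (hw : 0 ≤ w) (hv : 0 ≤ v) (hwv : v = 0 → w = 0) :
    Real.negMulLog w ≤ -(w * Real.log v) + v - w := by
  rcases hw.eq_or_lt with rfl | hw'
  · simpa using hv
  have hv' : 0 < v := lt_of_le_of_ne hv fun h => hw'.ne' (hwv h.symm)
  have h := Real.log_le_sub_one_of_pos (div_pos hv' hw')
  rw [Real.log_div hv'.ne' hw'.ne'] at h
  have h2 := mul_le_mul_of_nonneg_left h hw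
  have h3 : w * (v / w - 1) = v - w := by field_simp
  rw [h3] at h2
  simp only [Real.negMulLog]
  linarith

lemma sum_negMulLog_le {α : Type*} (T : Finset α) (w : α → ℝ) (hw : ∀ a ∈ T, 0 ≤ w a) {N : ℝ}
    (hN : (T.card : ℝ) ≤ N) :
    ∑ a ∈ T, Real.negMulLog (w a) ≤
      Real.negMulLog (∑ a ∈ T, w a) + (∑ a ∈ T, w a) * Real.log N := by
  set W := ∑ a ∈ T, w a with hW
  have hW0 : 0 ≤ W := Finset.sum_nonneg hw
  rcases hW0.eq_or_lt with h0 | hpos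
  · have : ∀ a ∈ T, w a = 0 := (Finset.sum_eq_zero_iff_of_nonneg hw).1 (hW.symm.trans h0.symm)
    rw [← h0, Finset.sum_eq_zero fun a ha => by rw [this a ha, Real.negMulLog_zero]]
    simp
  have hne : T.Nonempty := by
    by_contra h
    rw [Finset.not_nonempty_iff_eq_empty] at h
    simp [hW, h] at hpos
  have hc : (0 : ℝ) < T.card := by exact_mod_cast hne.card_pos
  have hNpos : 0 < N := hc.trans_le hN
  calc ∑ a ∈ T, Real.negMulLog (w a)
      ≤ ∑ a ∈ T, (-(w a * Real.log (W / N)) + W / N - w a) :=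
        Finset.sum_le_sum fun a ha =>
          negMulLog_le_cross (hw a ha) (by positivity)
            fun h => absurd h (div_pos hpos hNpos).ne'
    _ = -(W * Real.log (W / N)) + T.card * (W / N) - W := by
        rw [Finset.sum_sub_distrib, Finset.sum_add_distrib, Finset.sum_neg_distrib,
          ← Finset.sum_mul, Finset.sum_const, nsmul_eq_mul]
    _ ≤ -(W * Real.log (W / N)) := by
        have : T.card * (W / N) ≤ W := by
          rw [mul_div_assoc', div_le_iff₀ hNpos, mul_comm]
          exact mul_le_mul_of_nonneg_left hN hW0
        linarith
    _ = _ := by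
        rw [Real.log_div hpos.ne' hNpos.ne', Real.negMulLog]
        ring

lemma negMulLog_sum_le {α : Type*} (T : Finset α) (w : α → ℝ) (hw : ∀ a ∈ T, 0 ≤ w a) :
    Real.negMulLog (∑ a ∈ T, w a) ≤ ∑ a ∈ T, Real.negMulLog (w a) := by
  rw [Real.negMulLog, neg_mul, Finset.sum_mul, ← Finset.sum_neg_distrib]
  refine Finset.sum_le_sum fun a ha => ?_
  rcases (hw a ha).eq_or_lt with h | h
  · simp [← h]
  · rw [Real.negMulLog, neg_mul]
    exact neg_le_neg (mul_le_mul_of_nonneg_left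
      (Real.log_le_log h (Finset.single_le_sum hw ha)) h.le)

/-- Entropy, in nats, of the partition into fibres of `X`. -/
def fent {Ω ι : Type*} [MeasurableSpace Ω] (P : Measure Ω) (X : Ω → ι) : ℝ :=
  ∑' a, Real.negMulLog (P.real (X ⁻¹' {a}))

section

variable {Ω ι κ : Type*} [MeasurableSpace Ω] {P : Measure Ω}

lemma real_fibre_eq_zero {X : Ω → ι} {s : Finset ι} (hs : ∀ᵐ ω ∂P, X ω ∈ s) {a : ι}
    (ha : a ∉ s) : P.real (X ⁻¹' {a}) = 0 := by
  rw [Measure.real, ENNReal.toReal_eq_zero_iff]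
  left
  refine measure_mono_null ?_ (ae_iff.1 hs)
  rintro ω rfl
  exact ha

lemma fent_eq_sum {X : Ω → ι} {s : Finset ι} (hs : ∀ᵐ ω ∂P, X ω ∈ s) :
    fent P X = ∑ a ∈ s, Real.negMulLog (P.real (X ⁻¹' {a})) :=
  tsum_eq_sum fun a ha => by rw [real_fibre_eq_zero hs ha, Real.negMulLog_zero]

lemma real_eq_sum_inter_fibre [IsFiniteMeasure P] [MeasurableSpace κ] [MeasurableSingletonClass κ]
    {Y : Ω → κ} (hY : Measurable Y) {t : Finset κ} (ht : ∀ᵐ ω ∂P, Y ω ∈ t) {A : Set Ω}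
    (hA : MeasurableSet A) : P.real A = ∑ b ∈ t, P.real (A ∩ Y ⁻¹' {b}) := by
  rw [← measureReal_biUnion_finset]
  · refine measureReal_congr ?_
    filter_upwards [ht] with ω hω
    refine propext ⟨fun h => ?_, fun h => ?_⟩
    · exact mem_iUnion₂.2 ⟨Y ω, hω, h, rfl⟩
    · obtain ⟨b, -, h, -⟩ := mem_iUnion₂.1 h
      exact h
  · intro b _ b' _ hbb
    refine disjoint_left.2 ?_
    rintro ω ⟨-, rfl⟩ ⟨-, h⟩
    exact hbb h
  · exact fun b _ => hA.inter (hY (measurableSet_singleton b))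

lemma sum_real_fibre [IsProbabilityMeasure P] [MeasurableSpace κ] [MeasurableSingletonClass κ]
    {Y : Ω → κ} (hY : Measurable Y) {t : Finset κ} (ht : ∀ᵐ ω ∂P, Y ω ∈ t) :
    ∑ b ∈ t, P.real (Y ⁻¹' {b}) = 1 := by
  have := real_eq_sum_inter_fibre hY ht MeasurableSet.univ
  simpa using this.symm

lemma fent_nonneg [IsZeroOrProbabilityMeasure P] (X : Ω → ι) : 0 ≤ fent P X :=
  tsum_nonneg fun _ => Real.negMulLog_nonneg measureReal_nonneg measureReal_le_one

variable [MeasurableSpace ι] [MeasurableSingletonClass ι]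

lemma fent_le_log_card [IsProbabilityMeasure P] {X : Ω → ι} (hX : Measurable X) {s : Finset ι}
    (hs : ∀ᵐ ω ∂P, X ω ∈ s) : fent P X ≤ Real.log s.card := by
  rw [fent_eq_sum hs]
  have := sum_negMulLog_le s (fun a => P.real (X ⁻¹' {a})) (fun _ _ => measureReal_nonneg) le_rfl
  simpa [sum_real_fibre hX hs] using this

variable [MeasurableSpace κ] [MeasurableSingletonClass κ]

/-- If the fibres of `Y` meet at most `N` fibres of `X`, then the entropy of `X` exceeds that
of `Y` by at most `log N`. -/
lemma fent_le_add_log [IsProbabilityMeasure P] {X : Ω → ι} (hX : Measurable X) {s : Finset ι}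
    (hs : ∀ᵐ ω ∂P, X ω ∈ s) {Y : Ω → κ} (hY : Measurable Y) {t : Finset κ}
    (ht : ∀ᵐ ω ∂P, Y ω ∈ t) (T : ι → Finset ι) {N : ℝ} (hN : ∀ a, ((T a).card : ℝ) ≤ N)
    (hT : ∀ ω ω', Y ω = Y ω' → X ω ∈ T (X ω')) :
    fent P X ≤ fent P Y + Real.log N := by
  classical
  rw [fent_eq_sum hs, fent_eq_sum ht]
  have h1 : ∀ a ∈ s, Real.negMulLog (P.real (X ⁻¹' {a})) ≤
      ∑ b ∈ t, Real.negMulLog (P.real (X ⁻¹' {a} ∩ Y ⁻¹' {b})) := by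
    intro a _
    rw [real_eq_sum_inter_fibre hY ht (hX (measurableSet_singleton a))]
    exact negMulLog_sum_le _ _ fun _ _ => measureReal_nonneg
  have h2 : ∀ b ∈ t, ∑ a ∈ s, Real.negMulLog (P.real (X ⁻¹' {a} ∩ Y ⁻¹' {b})) ≤
      Real.negMulLog (P.real (Y ⁻¹' {b})) + P.real (Y ⁻¹' {b}) * Real.log N := by
    intro b _
    have hsum : P.real (Y ⁻¹' {b}) = ∑ a ∈ s, P.real (X ⁻¹' {a} ∩ Y ⁻¹' {b}) := by
      rw [real_eq_sum_inter_fibre hX hs (hY (measurableSet_singleton b))]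
      simp_rw [inter_comm]
    obtain ⟨U, hUN, hU⟩ : ∃ U : Finset ι, (U.card : ℝ) ≤ N ∧
        ∀ a ∉ U, P.real (X ⁻¹' {a} ∩ Y ⁻¹' {b}) = 0 := by
      by_cases hb : ∃ ω, Y ω = b
      · obtain ⟨ω, rfl⟩ := hb
        refine ⟨T (X ω), hN _, fun a ha => ?_⟩
        have : X ⁻¹' {a} ∩ Y ⁻¹' {Y ω} = ∅ := by
          refine eq_empty_of_forall_notMem ?_
          rintro ω' ⟨rfl, h⟩
          exact ha (hT _ _ h)
        simp [this]
      · obtain ⟨ω⟩ : Nonempty Ω := P.nonempty_of_neZero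
        refine ⟨∅, le_trans (by simp) (hN (X ω)), fun a _ => ?_⟩
        have : Y ⁻¹' {b} = ∅ := eq_empty_of_forall_notMem fun ω hω => hb ⟨ω, hω⟩
        simp [this]
    have hinter : ∀ F : ℝ → ℝ, F 0 = 0 →
        ∑ a ∈ s ∩ U, F (P.real (X ⁻¹' {a} ∩ Y ⁻¹' {b})) =
          ∑ a ∈ s, F (P.real (X ⁻¹' {a} ∩ Y ⁻¹' {b})) := by
      intro F hF
      refine Finset.sum_subset Finset.inter_subset_left fun a ha h => ?_
      rw [hU a fun h' => h (Finset.mem_inter.2 ⟨ha, h'⟩), hF]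
    have hcard : ((s ∩ U).card : ℝ) ≤ N :=
      le_trans (by exact_mod_cast Finset.card_le_card Finset.inter_subset_right) hUN
    have := sum_negMulLog_le (s ∩ U) (fun a => P.real (X ⁻¹' {a} ∩ Y ⁻¹' {b}))
      (fun _ _ => measureReal_nonneg) hcard
    rw [hinter Real.negMulLog Real.negMulLog_zero, hinter (fun x => x) rfl, ← hsum] at this
    exact this
  calc _ ≤ ∑ a ∈ s, ∑ b ∈ t, Real.negMulLog (P.real (X ⁻¹' {a} ∩ Y ⁻¹' {b})) :=
        Finset.sum_le_sum h1
    _ = ∑ b ∈ t, ∑ a ∈ s, Real.negMulLog (P.real (X ⁻¹' {a} ∩ Y ⁻¹' {b})) := Finset.sum_comm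
    _ ≤ _ := Finset.sum_le_sum h2
    _ = _ := by rw [Finset.sum_add_distrib, ← Finset.sum_mul, sum_real_fibre hY ht, one_mul]

lemma fent_pi_le {J : Type*} [Fintype J] [IsProbabilityMeasure P]
    {X : J → Ω → ι} (hX : ∀ j, Measurable (X j)) {s : J → Finset ι}
    (hs : ∀ j, ∀ᵐ ω ∂P, X j ω ∈ s j) :
    fent P (fun ω j => X j ω) ≤ ∑ j, fent P (X j) := by
  classical
  set Z : Ω → J → ι := fun ω j => X j ω
  have hZ : Measurable Z := measurable_pi_lambda _ hX
  have hsZ : ∀ᵐ ω ∂P, Z ω ∈ Fintype.piFinset s := by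
    filter_upwards [ae_all_iff.2 hs] with ω hω
    exact Fintype.mem_piFinset.2 hω
  have hmarg : ∀ j a, P.real (X j ⁻¹' {a}) =
      ∑ f ∈ Fintype.piFinset s, if f j = a then P.real (Z ⁻¹' {f}) else 0 := by
    intro j a
    rw [real_eq_sum_inter_fibre hZ hsZ (hX j (measurableSet_singleton a))]
    refine Finset.sum_congr rfl fun f _ => ?_
    split_ifs with h
    · congr 1
      refine inter_eq_right.2 ?_
      rintro ω rfl
      exact h
    · have : X j ⁻¹' {a} ∩ Z ⁻¹' {f} = ∅ := by
        refine eq_empty_of_forall_notMem ?_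
        rintro ω ⟨h1, rfl⟩
        exact h h1
      simp [this]
  have hle : ∀ j f, P.real (Z ⁻¹' {f}) ≤ P.real (X j ⁻¹' {f j}) := by
    intro j f
    refine measureReal_mono ?_
    rintro ω rfl
    rfl
  have hent : ∀ j, fent P (X j) =
      ∑ f ∈ Fintype.piFinset s, -(P.real (Z ⁻¹' {f}) * Real.log (P.real (X j ⁻¹' {f j}))) := by
    intro j
    rw [fent_eq_sum (hs j)]
    have : ∀ a, Real.negMulLog (P.real (X j ⁻¹' {a})) = ∑ f ∈ Fintype.piFinset s,
        if f j = a then -(P.real (Z ⁻¹' {f}) * Real.log (P.real (X j ⁻¹' {a}))) else 0 := by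
      intro a
      rw [Real.negMulLog, neg_mul]
      nth_rw 1 [hmarg]
      rw [Finset.sum_mul, ← Finset.sum_neg_distrib]
      refine Finset.sum_congr rfl fun f _ => ?_
      split_ifs <;> simp
    simp_rw [this]
    rw [Finset.sum_comm]
    refine Finset.sum_congr rfl fun f hf => ?_
    rw [Finset.sum_ite_eq, if_pos (Fintype.mem_piFinset.1 hf j)]
  rw [fent_eq_sum hsZ]
  have key : ∀ f ∈ Fintype.piFinset s, Real.negMulLog (P.real (Z ⁻¹' {f})) ≤
      ∑ j, -(P.real (Z ⁻¹' {f}) * Real.log (P.real (X j ⁻¹' {f j}))) +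
        ∏ j, P.real (X j ⁻¹' {f j}) - P.real (Z ⁻¹' {f}) := by
    intro f _
    have h0 : (∏ j, P.real (X j ⁻¹' {f j})) = 0 → P.real (Z ⁻¹' {f}) = 0 := by
      intro h
      obtain ⟨j, -, hj⟩ := Finset.prod_eq_zero_iff.1 h
      exact le_antisymm (hj ▸ hle j f) measureReal_nonneg
    have h := negMulLog_le_cross (w := P.real (Z ⁻¹' {f})) measureReal_nonneg
      (Finset.prod_nonneg fun j _ => measureReal_nonneg) h0
    refine h.trans_eq ?_
    congr 2
    rw [Finset.sum_neg_distrib, ← Finset.mul_sum]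
    by_cases hz : P.real (Z ⁻¹' {f}) = 0
    · simp [hz]
    · rw [Real.log_prod fun j _ hj => hz (le_antisymm (hj ▸ hle j f) measureReal_nonneg)]
  refine (Finset.sum_le_sum key).trans_eq ?_
  rw [Finset.sum_sub_distrib, Finset.sum_add_distrib, sum_real_fibre hZ hsZ, Finset.sum_comm,
    Finset.sum_congr rfl fun j _ => (hent j).symm,
    ← Finset.prod_univ_sum s fun j a => P.real (X j ⁻¹' {a}),
    Finset.prod_congr rfl fun j _ => sum_real_fibre (hX j) (hs j)]
  simp

/-- Chain rule for the entropy of a partition refining another one. -/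
lemma fent_eq_add_sum_cond [IsProbabilityMeasure P] {X : Ω → ι} (hX : Measurable X)
    {s : Finset ι} (hs : ∀ᵐ ω ∂P, X ω ∈ s) {Y : Ω → κ} (hY : Measurable Y) {t : Finset κ}
    (ht : ∀ᵐ ω ∂P, Y ω ∈ t) {g : ι → κ} (hg : ∀ ω, Y ω = g (X ω)) :
    fent P X = fent P Y +
      ∑ b ∈ t, P.real (Y ⁻¹' {b}) * fent (ProbabilityTheory.cond P (Y ⁻¹' {b})) X := by
  have hY' := fun b => hY (measurableSet_singleton b)
  have hcond : ∀ b, P.real (Y ⁻¹' {b}) * fent (ProbabilityTheory.cond P (Y ⁻¹' {b})) X =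
      ∑ a ∈ s, Real.negMulLog (P.real (X ⁻¹' {a} ∩ Y ⁻¹' {b})) -
        Real.negMulLog (P.real (Y ⁻¹' {b})) := by
    intro b
    have hsum : P.real (Y ⁻¹' {b}) = ∑ a ∈ s, P.real (X ⁻¹' {a} ∩ Y ⁻¹' {b}) := by
      rw [real_eq_sum_inter_fibre hX hs (hY' b)]
      simp_rw [inter_comm]
    set W := P.real (Y ⁻¹' {b})
    rcases (measureReal_nonneg : 0 ≤ W).eq_or_lt with h | h
    · change 0 = W at h
      change W * _ = _ - Real.negMulLog W
      rw [← h] at hsum ⊢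
      have := (Finset.sum_eq_zero_iff_of_nonneg fun a _ => measureReal_nonneg).1 hsum.symm
      rw [Finset.sum_eq_zero fun a ha => by rw [this a ha, Real.negMulLog_zero]]
      simp
    · change 0 < W at h
      rw [fent_eq_sum (ProbabilityTheory.cond_absolutelyContinuous.ae_le hs), Finset.mul_sum]
      have hW : W ≠ 0 := h.ne'
      have h1 : ∀ a ∈ s, W * Real.negMulLog
          ((ProbabilityTheory.cond P (Y ⁻¹' {b})).real (X ⁻¹' {a})) =
          Real.negMulLog (P.real (X ⁻¹' {a} ∩ Y ⁻¹' {b})) +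
            P.real (X ⁻¹' {a} ∩ Y ⁻¹' {b}) * Real.log W := by
        intro a _
        rw [Measure.real, ProbabilityTheory.cond_apply (hY' b), inter_comm, ENNReal.toReal_mul,
          ENNReal.toReal_inv]
        set w := P.real (X ⁻¹' {a} ∩ Y ⁻¹' {b})
        change W * Real.negMulLog (W⁻¹ * w) = _
        rw [Real.negMulLog_mul, Real.negMulLog, Real.log_inv]
        field_simp
        ring
      rw [Finset.sum_congr rfl h1, Finset.sum_add_distrib, ← Finset.sum_mul, ← hsum,
        Real.negMulLog]
      ring
  simp_rw [hcond]
  rw [Finset.sum_sub_distrib, ← fent_eq_sum ht, add_sub_cancel, fent_eq_sum hs, Finset.sum_comm]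
  refine Finset.sum_congr rfl fun a _ => ?_
  by_cases ha : g a ∈ t
  · rw [Finset.sum_eq_single_of_mem (g a) ha]
    · congr 2
      symm
      refine inter_eq_left.2 ?_
      rintro ω rfl
      exact hg ω
    · intro b _ hb
      have : X ⁻¹' {a} ∩ Y ⁻¹' {b} = ∅ := by
        refine eq_empty_of_forall_notMem ?_
        rintro ω ⟨rfl, rfl⟩
        exact hb (hg ω)
      simp [this]
  · have h0 : P.real (X ⁻¹' {a}) = 0 := by
      refine le_antisymm ?_ measureReal_nonneg
      rw [← real_fibre_eq_zero ht ha]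
      refine measureReal_mono ?_
      rintro ω rfl
      exact hg ω
    rw [h0, Finset.sum_eq_zero, Real.negMulLog_zero]
    intro b _
    have : P.real (X ⁻¹' {a} ∩ Y ⁻¹' {b}) = 0 :=
      le_antisymm (h0 ▸ measureReal_mono inter_subset_left) measureReal_nonneg
    rw [this, Real.negMulLog_zero]

end

end DiscreteEntropy

section SelfConformal

lemma exists_abs_sub_eq_of_hasDerivWithinAt {f f' : ℝ → ℝ}
    (hf : ∀ x ∈ unitI, HasDerivWithinAt f (f' x) unitI x) {x y : ℝ} (hx : x ∈ unitI)
    (hy : y ∈ unitI) : ∃ c ∈ unitI, |f x - f y| = |f' c| * |x - y| := by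
  wlog hxy : y ≤ x generalizing x y
  · obtain ⟨c, hc, h⟩ := this hy hx (le_of_not_ge hxy)
    exact ⟨c, hc, by rw [abs_sub_comm, h, abs_sub_comm y]⟩
  rcases hxy.eq_or_lt with rfl | hlt
  · exact ⟨y, hy, by simp⟩
  have hsub : Icc y x ⊆ unitI := Icc_subset_Icc hy.1 hx.2
  obtain ⟨c, hc, h⟩ := exists_hasDerivAt_eq_slope f f' hlt
    (fun z hz => ((hf z (hsub hz)).continuousWithinAt).mono hsub)
    (fun z hz => (hf z (hsub (Ioo_subset_Icc_self hz))).hasDerivAt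
      (Icc_mem_nhds (hy.1.trans_lt hz.1) (hz.2.trans_le hx.2)))
  refine ⟨c, hsub (Ioo_subset_Icc_self hc), ?_⟩
  rw [h, ← abs_mul, div_mul_cancel₀ _ (sub_pos.2 hlt).ne']

variable {Λ : Type*} [Fintype Λ] {φ : Λ → ℝ → ℝ} {p : Λ → ℝ} {μ : Measure ℝ}

lemma aemeasurable_of_continuousOn_unitI (hμI : μ unitIᶜ = 0) {f : ℝ → ℝ}
    (hf : ContinuousOn f unitI) : AEMeasurable f μ := by
  have h := hf.aemeasurable (μ := μ) (s := unitI) measurableSet_Icc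
  rwa [Measure.restrict_eq_self_of_ae_mem (s := unitI) (mem_ae_iff.2 hμI)] at h

lemma mapsTo_support (hp : ∀ i, 0 < p i) (hμI : μ unitIᶜ = 0)
    (hφ : ∀ i, ∀ x ∈ unitI, ContinuousAt (φ i) x)
    (hμ : μ = ∑ i : Λ, ENNReal.ofReal (p i) • Measure.map (φ i) μ) (i : Λ) :
    MapsTo (φ i) μ.support μ.support := by
  intro x hx
  have hxI : x ∈ unitI :=
    Measure.support_subset_of_isClosed isClosed_Icc (mem_ae_iff.2 hμI) hx
  rw [Measure.mem_support_iff_forall] at hx ⊢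
  intro U hU
  have h1 := hx _ (hφ i x hxI hU)
  have hmeas : AEMeasurable (φ i) μ := aemeasurable_of_continuousOn_unitI hμI
    fun y hy => (hφ i y hy).continuousWithinAt
  calc (0 : ENNReal) < ENNReal.ofReal (p i) * μ (φ i ⁻¹' U) :=
        ENNReal.mul_pos (ENNReal.ofReal_pos.2 (hp i)).ne' h1.ne'
    _ ≤ ENNReal.ofReal (p i) * Measure.map (φ i) μ U := by
        exact mul_le_mul_right (Measure.le_map_apply hmeas U) _
    _ ≤ ∑ j : Λ, ENNReal.ofReal (p j) * Measure.map (φ j) μ U :=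
        Finset.single_le_sum (f := fun j => ENNReal.ofReal (p j) * Measure.map (φ j) μ U)
          (fun _ _ => zero_le) (Finset.mem_univ i)
    _ = μ U := by
        conv_rhs => rw [hμ]
        simp [Measure.finsetSum_apply]

/-- A self-conformal measure whose maps have no common fixed point has infinite support. -/
lemma infinite_support [Nonempty Λ] [IsProbabilityMeasure μ] (hp : ∀ i, 0 < p i)
    (hμI : μ unitIᶜ = 0)
    (hdiff : ∀ i, ∀ x ∈ unitI, DifferentiableAt ℝ (φ i) x)
    (hderiv : ∀ i, ∀ x ∈ unitI, 0 < |deriv (φ i) x| ∧ |deriv (φ i) x| < 1)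
    (hnofix : ¬ ∃ x ∈ unitI, ∀ i, φ i x = x)
    (hμ : μ = ∑ i : Λ, ENNReal.ofReal (p i) • Measure.map (φ i) μ) :
    μ.support.Infinite := by
  intro hfin
  have hsub : μ.support ⊆ unitI :=
    Measure.support_subset_of_isClosed isClosed_Icc (mem_ae_iff.2 hμI)
  have hmaps := mapsTo_support hp hμI (fun i x hx => (hdiff i x hx).continuousAt) hμ
  have hmvt : ∀ i, ∀ x ∈ unitI, ∀ y ∈ unitI, x ≠ y →
      0 < |φ i x - φ i y| ∧ |φ i x - φ i y| < |x - y| := by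
    intro i x hx y hy hxy
    obtain ⟨c, hc, h⟩ := exists_abs_sub_eq_of_hasDerivWithinAt
      (fun z hz => (hdiff i z hz).hasDerivAt.hasDerivWithinAt) hx hy
    have hpos : 0 < |x - y| := abs_pos.2 (sub_ne_zero.2 hxy)
    rw [h]
    exact ⟨mul_pos (hderiv i c hc).1 hpos, mul_lt_of_lt_one_left hpos (hderiv i c hc).2⟩
  have hinj : ∀ i, InjOn (φ i) μ.support := by
    intro i x hx y hy hxy
    by_contra hne
    have := (hmvt i x (hsub hx) y (hsub hy) hne).1
    simp [hxy] at this
  have hne : μ.support.Nonempty := Measure.nonempty_support (IsProbabilityMeasure.ne_zero μ)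
  have hsurj : ∀ i, SurjOn (φ i) μ.support μ.support := fun i =>
    ((hfin.injOn_iff_bijOn_of_mapsTo (hmaps i)).1 (hinj i)).surjOn
  obtain ⟨⟨x, y⟩, ⟨hx, hy⟩, hmax⟩ :=
    (hfin.prod hfin).exists_maximalFor (fun z : ℝ × ℝ => |z.1 - z.2|) _ (hne.prod hne)
  have hmax' : ∀ x' ∈ μ.support, ∀ y' ∈ μ.support, |x' - y'| ≤ |x - y| := by
    intro x' hx' y' hy'
    by_contra! h
    exact absurd (hmax (j := (x', y')) ⟨hx', hy'⟩ h.le) (not_le.2 h)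
  obtain ⟨i⟩ := ‹Nonempty Λ›
  obtain ⟨x', hx', rfl⟩ := hsurj i hx
  obtain ⟨y', hy', rfl⟩ := hsurj i hy
  have hxy : x' = y' := by
    by_contra h
    exact absurd (hmax' x' hx' y' hy') (not_le.2 (hmvt i x' (hsub hx') y' (hsub hy') h).2)
  subst hxy
  refine hnofix ⟨x', hsub hx', fun j => ?_⟩
  have := hmax' _ (hmaps j hx') _ hx'
  simpa [sub_eq_zero] using this

lemma exists_separated_sets [IsFiniteMeasure μ] (hμI : μ unitIᶜ = 0)
    (hinf : μ.support.Infinite) (k : ℕ) :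
    ∃ A : Fin (k + 1) → Set ℝ, ∃ ρ c : ℝ, 0 < ρ ∧ 0 < c ∧ (∀ j, A j ⊆ unitI) ∧
      (∀ i j, i ≠ j → ∀ x ∈ A i, ∀ y ∈ A j, ρ ≤ |x - y|) ∧ ∀ j, c ≤ μ.real (A j) := by
  obtain ⟨y, hy, hinj⟩ : ∃ y : Fin (k + 1) → ℝ, (∀ j, y j ∈ μ.support) ∧
      Function.Injective y :=
    ⟨fun j => hinf.natEmbedding _ j, fun j => (hinf.natEmbedding _ j).2,
      fun a b h => Fin.ext ((hinf.natEmbedding _).injective (Subtype.ext h))⟩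
  obtain ⟨ρ, hρ, hsep⟩ : ∃ ρ : ℝ, 0 < ρ ∧ ∀ i j, i ≠ j → 3 * ρ ≤ |y i - y j| := by
    obtain ⟨z, hz⟩ := Finite.exists_min
      fun z : Fin (k + 1) × Fin (k + 1) => if z.1 = z.2 then (1 : ℝ) else |y z.1 - y z.2|
    refine ⟨(if z.1 = z.2 then (1 : ℝ) else |y z.1 - y z.2|) / 3, ?_, fun i j hij => ?_⟩
    · split_ifs with h
      · norm_num
      · have := abs_pos.2 (sub_ne_zero.2 (hinj.ne h))
        positivity
    · have := hz (i, j)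
      simp only [if_neg hij] at this
      linarith
  have hpos : ∀ j, 0 < μ.real (ball (y j) ρ ∩ unitI) := by
    intro j
    rw [measureReal_def, measure_inter_conull hμI]
    exact ENNReal.toReal_pos
      ((Measure.mem_support_iff_forall _).1 (hy j) _ (ball_mem_nhds _ hρ)).ne'
      (measure_ne_top _ _)
  obtain ⟨j, hj⟩ := Finite.exists_min fun j => μ.real (ball (y j) ρ ∩ unitI)
  refine ⟨fun j => ball (y j) ρ ∩ unitI, ρ, _, hρ, hpos j, fun j => inter_subset_right, ?_, hj⟩
  rintro i j hij x ⟨hx, -⟩ x' ⟨hx', -⟩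
  have h := hsep i j hij
  rw [mem_ball, Real.dist_eq] at hx hx'
  have h1 : |y i - y j| ≤ |y i - x| + |x - x'| + |x' - y j| :=
    (abs_sub_le _ x' _).trans (by gcongr; exact abs_sub_le _ _ _)
  rw [abs_sub_comm (y i) x] at h1
  linarith

end SelfConformal

section Cells

/-- The index of the level-`n` dyadic cell containing `q`. -/
def cellIdx (d n : ℕ) (q : EuclideanSpace ℝ (Fin d)) : Fin d → ℤ := fun j => ⌊q j * 2 ^ n⌋

/-- The index of the level-`n` dyadic interval containing the value of `a` at `x`. -/
def valIdx (k n : ℕ) (x : ℝ) (a : EuclideanSpace ℝ (Fin (k + 1))) : ℤ :=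
  ⌊polyEval k a x * 2 ^ n⌋

lemma mem_dyadIco_iff {n : ℕ} {m : ℤ} {x : ℝ} : x ∈ dyadIco n m ↔ ⌊x * 2 ^ n⌋ = m := by
  have h : (0 : ℝ) < 2 ^ n := by positivity
  rw [dyadIco, mem_Ico, Int.floor_eq_iff, div_le_iff₀ h, lt_div_iff₀ h]

lemma vcell_eq_preimage (d n : ℕ) (m : Fin d → ℤ) : vcell d n m = cellIdx d n ⁻¹' {m} := by
  ext q
  exact (forall_congr' fun j => mem_dyadIco_iff).trans funext_iff.symm

lemma measurable_cellIdx (d n : ℕ) : Measurable (cellIdx d n) := by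
  unfold cellIdx
  fun_prop

lemma continuous_polyEval (k : ℕ) :
    Continuous fun z : ℝ × EuclideanSpace ℝ (Fin (k + 1)) => polyEval k z.2 z.1 := by
  unfold polyEval
  fun_prop

lemma measurable_polyEval (k : ℕ) (x : ℝ) : Measurable fun a => polyEval k a x :=
  ((continuous_polyEval k).comp (Continuous.prodMk_right x)).measurable

lemma measurable_valIdx (k n : ℕ) (x : ℝ) : Measurable (valIdx k n x) :=
  ((measurable_polyEval k x).mul_const _).floor

lemma neg_tsum_mul_logb {α : Type*} (w : α → ℝ) :
    -∑' a, w a * Real.logb 2 (w a) = (∑' a, Real.negMulLog (w a)) / Real.log 2 := by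
  rw [← tsum_div_const, ← tsum_neg]
  refine tsum_congr fun a => ?_
  rw [Real.negMulLog, Real.logb]
  ring

lemma entV_eq (d n : ℕ) (θ : Measure (EuclideanSpace ℝ (Fin d))) :
    entV d n θ = DiscreteEntropy.fent θ (cellIdx d n) / Real.log 2 := by
  simp_rw [entV, vcell_eq_preimage]
  exact neg_tsum_mul_logb fun m => θ.real (cellIdx d n ⁻¹' {m})

lemma ent1_map_eq (k n : ℕ) (x : ℝ) (θ : Measure (EuclideanSpace ℝ (Fin (k + 1)))) :
    ent1 n (θ.map fun a => polyEval k a x) =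
      DiscreteEntropy.fent θ (valIdx k n x) / Real.log 2 := by
  have h : ∀ m : ℤ, θ.map (fun a => polyEval k a x) (dyadIco n m) = θ (valIdx k n x ⁻¹' {m}) := by
    intro m
    rw [Measure.map_apply (measurable_polyEval k x) (s := dyadIco n m) measurableSet_Ico]
    congr 1
    ext a
    exact mem_dyadIco_iff
  simp_rw [ent1, h]
  exact neg_tsum_mul_logb fun m => θ.real (valIdx k n x ⁻¹' {m})

lemma vcomp_eq_cond {d : ℕ} (ν : Measure (EuclideanSpace ℝ (Fin d)))
    (q : EuclideanSpace ℝ (Fin d)) (n : ℕ) :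
    vcomp ν q n = ProbabilityTheory.cond ν (cellIdx d n ⁻¹' {cellIdx d n q}) := by
  rw [← vcell_eq_preimage]
  rfl

lemma polyEval_sub (k : ℕ) (a b : EuclideanSpace ℝ (Fin (k + 1))) (x : ℝ) :
    polyEval k (a - b) x = polyEval k a x - polyEval k b x := by
  simp [polyEval, sub_mul, Finset.sum_sub_distrib]

lemma polyEval_smul (k : ℕ) (c : ℝ) (a : EuclideanSpace ℝ (Fin (k + 1))) (x : ℝ) :
    polyEval k (c • a) x = c * polyEval k a x := by
  simp [polyEval, mul_assoc, Finset.mul_sum]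

lemma abs_coord_le {d : ℕ} (a : EuclideanSpace ℝ (Fin d)) (j : Fin d) : |a j| ≤ ‖a‖ :=
  PiLp.norm_apply_le a j

lemma abs_polyEval_le (k : ℕ) (a : EuclideanSpace ℝ (Fin (k + 1))) {x : ℝ} (hx : x ∈ unitI) :
    |polyEval k a x| ≤ (k + 1) * ‖a‖ := by
  calc |polyEval k a x| ≤ ∑ j : Fin (k + 1), |a j * x ^ (j : ℕ)| := Finset.abs_sum_le_sum_abs _ _
    _ ≤ ∑ _j : Fin (k + 1), ‖a‖ := by
        refine Finset.sum_le_sum fun j _ => ?_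
        rw [abs_mul, abs_of_nonneg (pow_nonneg hx.1 _)]
        exact (mul_le_of_le_one_right (abs_nonneg _) (pow_le_one₀ hx.1 hx.2)).trans
          (abs_coord_le a j)
    _ = _ := by simp

lemma floor_mem_Icc_of_abs_le {y R : ℝ} (n : ℕ) (h : |y| ≤ R) :
    ⌊y * 2 ^ n⌋ ∈ Finset.Icc ⌊-R * 2 ^ n⌋ ⌊R * 2 ^ n⌋ := by
  rw [abs_le] at h
  rw [Finset.mem_Icc]
  constructor <;> gcongr
  exacts [h.1, h.2]

/-- The indices of the level-`n` cells that meet the ball of radius `R`. -/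
def cellBox (d n : ℕ) (R : ℝ) : Finset (Fin d → ℤ) :=
  Fintype.piFinset fun _ => Finset.Icc ⌊-R * 2 ^ n⌋ ⌊R * 2 ^ n⌋

lemma cellIdx_mem_cellBox {d : ℕ} (n : ℕ) {R : ℝ} {q : EuclideanSpace ℝ (Fin d)}
    (hq : ‖q‖ ≤ R) : cellIdx d n q ∈ cellBox d n R :=
  Fintype.mem_piFinset.2 fun j => floor_mem_Icc_of_abs_le n ((abs_coord_le q j).trans hq)

lemma polyEval_eq_zero_of_injective {k : ℕ} {x : Fin (k + 1) → ℝ} (hx : Function.Injective x)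
    {a : EuclideanSpace ℝ (Fin (k + 1))} (h : ∀ j, polyEval k a (x j) = 0) : a = 0 := by
  have h0 : a.ofLp = 0 := by
    refine Matrix.eq_zero_of_mulVec_eq_zero (Matrix.det_vandermonde_ne_zero_iff.2 hx) ?_
    ext j
    rw [Pi.zero_apply, ← h j]
    simp only [Matrix.mulVec, dotProduct, Matrix.vandermonde_apply, polyEval]
    exact Finset.sum_congr rfl fun i _ => mul_comm _ _
  ext j
  exact congrFun h0 j

/-- The coefficients of a polynomial are controlled by its values at separated points. -/
lemma exists_norm_le_of_separated (k : ℕ) {δ : ℝ} (hδ : 0 < δ) :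
    ∃ K : ℝ, 0 ≤ K ∧ ∀ x : Fin (k + 1) → ℝ, (∀ j, x j ∈ unitI) →
      (∀ i j, i ≠ j → δ ≤ |x i - x j|) → ∀ (a : EuclideanSpace ℝ (Fin (k + 1))) (η : ℝ),
        (∀ j, |polyEval k a (x j)| ≤ η) → ‖a‖ ≤ K * η := by
  set T : Set (Fin (k + 1) → ℝ) :=
    (univ.pi fun _ => unitI) ∩ {x | ∀ i j, i ≠ j → δ ≤ |x i - x j|}
  have hT : IsCompact T := by
    refine (isCompact_univ_pi fun _ => isCompact_Icc).inter_right ?_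
    simp only [ofPred_forall]
    refine isClosed_iInter fun i => isClosed_iInter fun j => isClosed_iInter fun _ => ?_
    exact isClosed_le (by fun_prop) (by fun_prop)
  have hC := hT.prod (isCompact_sphere (0 : EuclideanSpace ℝ (Fin (k + 1))) 1)
  have hcont : Continuous fun z : (Fin (k + 1) → ℝ) × EuclideanSpace ℝ (Fin (k + 1)) =>
      ∑ j, |polyEval k z.2 (z.1 j)| := by
    unfold polyEval
    fun_prop
  obtain ⟨κ, hκ, hle⟩ := hC.exists_forall_le' hcont.continuousOn (a := 0) (by
    rintro ⟨x, a⟩ ⟨hx, ha⟩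
    refine (Finset.sum_nonneg fun j _ => abs_nonneg _).lt_of_ne fun h => ?_
    have h0 := (Finset.sum_eq_zero_iff_of_nonneg fun j _ => abs_nonneg _).1 h.symm
    have hinj : Function.Injective x := by
      intro i j hij
      by_contra hne
      have := hx.2 i j hne
      simp [hij] at this
      linarith
    have ha0 : a = 0 :=
      polyEval_eq_zero_of_injective hinj fun j => abs_eq_zero.1 (h0 j (Finset.mem_univ j))
    simp [ha0] at ha)
  refine ⟨(k + 1) / κ, by positivity, fun x hx hsep a η ha => ?_⟩
  rcases eq_or_ne a 0 with rfl | hne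
  · have : 0 ≤ η := (abs_nonneg _).trans (ha 0)
    simp only [norm_zero]
    positivity
  have hpos : 0 < ‖a‖ := norm_pos_iff.2 hne
  have h1 := hle (x, ‖a‖⁻¹ • a) ⟨⟨fun j _ => hx j, hsep⟩, by
    simp [norm_smul, hpos.ne']⟩
  simp only [polyEval_smul, abs_mul, abs_inv, abs_norm] at h1
  rw [← Finset.mul_sum, inv_mul_eq_div, le_div_iff₀ hpos] at h1
  have h2 : ∑ j, |polyEval k a (x j)| ≤ (k + 1) * η := by
    refine (Finset.sum_le_sum fun j _ => ha j).trans_eq ?_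
    simp
  rw [div_mul_eq_mul_div, le_div_iff₀ hκ, mul_comm]
  exact h1.trans h2

lemma abs_sub_le_of_floor_eq {y z : ℝ} {n : ℕ} (h : ⌊y * 2 ^ n⌋ = ⌊z * 2 ^ n⌋) :
    |y - z| ≤ ((2 : ℝ) ^ n)⁻¹ := by
  have := (Int.abs_sub_lt_one_of_floor_eq_floor h).le
  rw [← sub_mul, abs_mul, abs_of_pos (by positivity : (0 : ℝ) < 2 ^ n)] at this
  rwa [← one_div, le_div_iff₀ (by positivity)]

open DiscreteEntropy

variable {k : ℕ} {P : Measure (EuclideanSpace ℝ (Fin (k + 1)))} {R : ℝ}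

lemma ae_valIdx_mem (hR : ∀ᵐ q ∂P, ‖q‖ ≤ R) (n : ℕ) {x : ℝ} (hx : x ∈ unitI) :
    ∀ᵐ q ∂P, valIdx k n x q ∈
      Finset.Icc ⌊-((k + 1) * R) * 2 ^ n⌋ ⌊((k + 1) * R) * 2 ^ n⌋ := by
  filter_upwards [hR] with q hq
  refine floor_mem_Icc_of_abs_le n ((abs_polyEval_le k q hx).trans ?_)
  gcongr

lemma fent_cellIdx_le [IsProbabilityMeasure P] (hR : ∀ᵐ q ∂P, ‖q‖ ≤ R) {x : Fin (k + 1) → ℝ} (hx : ∀ j, x j ∈ unitI)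
    {K : ℕ} (hK : ∀ (a : EuclideanSpace ℝ (Fin (k + 1))) (η : ℝ),
      (∀ j, |polyEval k a (x j)| ≤ η) → ‖a‖ ≤ K * η) (n : ℕ) :
    fent P (cellIdx (k + 1) n) ≤
      ∑ j, fent P (valIdx k n (x j)) + Real.log ((2 * K + 3) ^ (k + 1)) := by
  have hval := fun j => measurable_valIdx k n (x j)
  have hae := fun j => ae_valIdx_mem hR n (hx j)
  refine le_trans ?_ (add_le_add_left (fent_pi_le hval hae) _)
  refine fent_le_add_log (measurable_cellIdx _ n) (hR.mono fun q hq => cellIdx_mem_cellBox n hq)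
    (measurable_pi_lambda _ hval) (t := Fintype.piFinset fun _ => _)
    ((ae_all_iff.2 hae).mono fun q hq => Fintype.mem_piFinset.2 hq)
    (fun a => Fintype.piFinset fun l => Finset.Icc (a l - (K + 1)) (a l + (K + 1))) ?_ ?_
  · intro a
    have : ∀ l, (a l + (K + 1) + 1 - (a l - (K + 1))).toNat = 2 * K + 3 := by
      intro l
      omega
    simp [Fintype.card_piFinset, this]
  · intro q q' hqq
    have hdist : ‖q - q'‖ ≤ K * ((2 : ℝ) ^ n)⁻¹ := by
      refine hK _ _ fun j => ?_
      rw [polyEval_sub]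
      exact abs_sub_le_of_floor_eq (congrFun hqq j)
    refine Fintype.mem_piFinset.2 fun l => ?_
    have h2 : (0 : ℝ) < 2 ^ n := by positivity
    have h3 : |q l * 2 ^ n - q' l * 2 ^ n| ≤ K := by
      rw [← sub_mul, abs_mul, abs_of_pos h2, ← le_div_iff₀ h2, div_eq_mul_inv]
      exact (abs_coord_le (q - q') l).trans hdist
    rw [abs_le] at h3
    have hq1 := Int.floor_le (q l * 2 ^ n)
    have hq2 := Int.lt_floor_add_one (q l * 2 ^ n)
    have hq3 := Int.floor_le (q' l * 2 ^ n)
    have hq4 := Int.lt_floor_add_one (q' l * 2 ^ n)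
    rw [Finset.mem_Icc]
    simp only [cellIdx]
    constructor
    · have : ((⌊q' l * 2 ^ n⌋ - (K + 1) : ℤ) : ℝ) < ⌊q l * 2 ^ n⌋ + 1 := by
        push_cast
        linarith
      have : ⌊q' l * 2 ^ n⌋ - (K + 1) < ⌊q l * 2 ^ n⌋ + 1 := by exact_mod_cast this
      omega
    · have : (⌊q l * 2 ^ n⌋ : ℝ) < ((⌊q' l * 2 ^ n⌋ + (K + 1) + 1 : ℤ) : ℝ) := by
        push_cast
        linarith
      have : ⌊q l * 2 ^ n⌋ < ⌊q' l * 2 ^ n⌋ + (K + 1) + 1 := by exact_mod_cast this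
      omega

lemma fent_valIdx_le [IsProbabilityMeasure P] {i : ℕ} {b : Fin (k + 1) → ℤ} (hb : ∀ᵐ q ∂P, cellIdx (k + 1) i q = b)
    (m : ℕ) {x : ℝ} (hx : x ∈ unitI) :
    fent P (valIdx k (i + m) x) ≤ m * Real.log 2 + Real.log (k + 2) := by
  set v : ℝ := (∑ j : Fin (k + 1), (b j : ℝ) * x ^ (j : ℕ)) * 2 ^ m with hv
  have hmem : ∀ᵐ q ∂P, valIdx k (i + m) x q ∈
      Finset.Icc ⌊v⌋ (⌊v⌋ + ((k + 1) * 2 ^ m : ℕ)) := by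
    filter_upwards [hb] with q hq
    have hcoord : ∀ j, (b j : ℝ) ≤ q j * 2 ^ i ∧ q j * 2 ^ i ≤ b j + 1 := by
      intro j
      rw [← hq]
      exact ⟨Int.floor_le _, (Int.lt_floor_add_one _).le⟩
    have hval : polyEval k q x * 2 ^ (i + m) =
        (∑ j : Fin (k + 1), (q j * 2 ^ i) * x ^ (j : ℕ)) * 2 ^ m := by
      rw [polyEval, pow_add, ← mul_assoc, Finset.sum_mul]
      congr 1
      exact Finset.sum_congr rfl fun j _ => by ring
    have hlow : v ≤ polyEval k q x * 2 ^ (i + m) := by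
      rw [hval, hv]
      gcongr with j
      · exact pow_nonneg hx.1 _
      · exact (hcoord j).1
    have hup : polyEval k q x * 2 ^ (i + m) ≤ v + ((k + 1) * 2 ^ m : ℕ) := by
      rw [hval, hv]
      push_cast
      rw [← add_mul]
      gcongr
      calc ∑ j : Fin (k + 1), (q j * 2 ^ i) * x ^ (j : ℕ)
          ≤ ∑ j : Fin (k + 1), ((b j : ℝ) * x ^ (j : ℕ) + 1) := by
            refine Finset.sum_le_sum fun j _ => ?_
            have h0 := pow_nonneg hx.1 (j : ℕ)
            have h1 := pow_le_one₀ (n := (j : ℕ)) hx.1 hx.2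
            nlinarith [mul_le_mul_of_nonneg_right (hcoord j).2 h0]
        _ = _ := by simp [Finset.sum_add_distrib]
    rw [Finset.mem_Icc, ← Int.floor_add_natCast]
    exact ⟨Int.floor_le_floor hlow, Int.floor_le_floor hup⟩
  refine (fent_le_log_card (measurable_valIdx _ _ _) hmem).trans ?_
  rw [Int.card_Icc]
  have : (⌊v⌋ + ((k + 1) * 2 ^ m : ℕ) + 1 - ⌊v⌋).toNat = (k + 1) * 2 ^ m + 1 := by
    omega
  rw [this, ← Real.log_pow, ← Real.log_mul (by positivity) (by positivity)]
  refine Real.log_le_log (by positivity) ?_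
  push_cast
  nlinarith [one_le_pow₀ (M₀ := ℝ) (a := 2) (n := m) (by norm_num)]

end Cells

section Multiscale

open DiscreteEntropy

variable {k : ℕ} {ν : Measure (EuclideanSpace ℝ (Fin (k + 1)))} {R : ℝ}

lemma mul_sub_le_sum_sub {h : ℕ → ℝ} (hmono : Monotone h) (m n : ℕ) :
    m * (h n - h m) ≤ ∑ i ∈ Finset.Icc 1 n, (h (i + m) - h i) := by
  have h1 : ∀ i, h (i + m) - h i = ∑ l ∈ Finset.range m, (h (i + (l + 1)) - h (i + l)) :=
    fun i => (Finset.sum_range_sub (fun l => h (i + l)) m).symm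
  have h2 : ∀ l, ∑ i ∈ Finset.Icc 1 n, (h (i + (l + 1)) - h (i + l)) =
      h (n + 1 + l) - h (1 + l) := by
    intro l
    have := Finset.sum_Ico_sub (fun i => h (i + l)) (show 1 ≤ n + 1 by omega)
    rw [← this, ← Finset.Ico_succ_right_eq_Icc]
    refine Finset.sum_congr rfl fun i _ => ?_
    rw [show i + (l + 1) = i + 1 + l by ring]
  simp_rw [h1]
  rw [Finset.sum_comm]
  simp_rw [h2]
  calc (m : ℝ) * (h n - h m) = ∑ _l ∈ Finset.range m, (h n - h m) := by
        rw [Finset.sum_const, Finset.card_range, nsmul_eq_mul]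
    _ ≤ _ := Finset.sum_le_sum fun l hl => by
        have := Finset.mem_range.1 hl
        exact sub_le_sub (hmono (by omega)) (hmono (by omega))

/-- The `ν`-proportion of components, over scales `1 ≤ i ≤ n`, whose image under evaluation at
`x` has normalized entropy exceeding `ε₀`. -/
def highEntropyProportion (k : ℕ) (ν : Measure (EuclideanSpace ℝ (Fin (k + 1)))) (ε₀ : ℝ)
    (m n : ℕ) (x : ℝ) : ℝ :=
  (1 / (n : ℝ)) * ∑ i ∈ Finset.Icc 1 n,
    (ν {q | ε₀ < (1 / (m : ℝ)) * ent1 (i + m)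
      ((vcomp ν q i).map fun a => polyEval k a x)}).toReal

lemma cellIdx_eq_div (d i m : ℕ) (q : EuclideanSpace ℝ (Fin d)) :
    cellIdx d i q = fun j => cellIdx d (i + m) q j / (2 ^ m : ℕ) := by
  ext j
  have h := Int.floor_div_natCast (q j * 2 ^ (i + m)) (2 ^ m)
  simp only [cellIdx]
  rw [← h]
  congr 1
  push_cast
  rw [pow_add]
  field_simp

lemma fent_cellIdx_add [IsProbabilityMeasure ν] (hR : ∀ᵐ q ∂ν, ‖q‖ ≤ R) (i m : ℕ) :
    fent ν (cellIdx (k + 1) (i + m)) = fent ν (cellIdx (k + 1) i) +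
      ∑ b ∈ cellBox (k + 1) i R, ν.real (cellIdx (k + 1) i ⁻¹' {b}) *
        fent (ProbabilityTheory.cond ν (cellIdx (k + 1) i ⁻¹' {b})) (cellIdx (k + 1) (i + m)) :=
  fent_eq_add_sum_cond (measurable_cellIdx _ _)
    (hR.mono fun _ hq => cellIdx_mem_cellBox (i + m) hq) (measurable_cellIdx _ _)
    (hR.mono fun _ hq => cellIdx_mem_cellBox i hq)
    (g := fun c j => c j / (2 ^ m : ℕ)) (cellIdx_eq_div (k + 1) i m)

lemma monotone_fent_cellIdx [IsProbabilityMeasure ν] (hR : ∀ᵐ q ∂ν, ‖q‖ ≤ R) :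
    Monotone fun i => fent ν (cellIdx (k + 1) i) := by
  refine monotone_nat_of_le_succ fun i => ?_
  rw [fent_cellIdx_add hR i 1]
  exact le_add_of_nonneg_right
    (Finset.sum_nonneg fun b _ => mul_nonneg measureReal_nonneg (fent_nonneg _))

lemma sum_fent_cond_valIdx_le [IsProbabilityMeasure ν] (hR : ∀ᵐ q ∂ν, ‖q‖ ≤ R) {ε₀ : ℝ}
    (hε₀ : 0 ≤ ε₀) {m : ℕ} (hm : 1 ≤ m) (i : ℕ) {x : ℝ} (hx : x ∈ unitI) :
    ∑ b ∈ cellBox (k + 1) i R, ν.real (cellIdx (k + 1) i ⁻¹' {b}) *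
        fent (ProbabilityTheory.cond ν (cellIdx (k + 1) i ⁻¹' {b})) (valIdx k (i + m) x) ≤
      m * (ε₀ * Real.log 2 + (Real.log 2 + Real.log (k + 2)) *
        (ν {q | ε₀ < (1 / (m : ℝ)) * ent1 (i + m)
          ((vcomp ν q i).map fun a => polyEval k a x)}).toReal) := by
  classical
  set Y := cellIdx (k + 1) i with hY
  have hYm : Measurable Y := measurable_cellIdx _ _
  have ht : ∀ᵐ q ∂ν, Y q ∈ cellBox (k + 1) i R := hR.mono fun _ hq => cellIdx_mem_cellBox i hq
  set g : (Fin (k + 1) → ℤ) → ℝ := fun b =>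
    fent (ProbabilityTheory.cond ν (Y ⁻¹' {b})) (valIdx k (i + m) x) with hg
  have hlog2 : 0 < Real.log 2 := Real.log_pos (by norm_num)
  have hlogk : 0 ≤ Real.log (k + 2) := Real.log_nonneg (by linarith [k.cast_nonneg (α := ℝ)])
  have hm0 : (1 : ℝ) ≤ m := by exact_mod_cast hm
  have hset : {q | ε₀ < (1 / (m : ℝ)) * ent1 (i + m)
      ((vcomp ν q i).map fun a => polyEval k a x)} =
      Y ⁻¹' {b | ε₀ * m * Real.log 2 < g b} := by
    ext q
    simp only [mem_ofPred_eq, mem_preimage, vcomp_eq_cond, ent1_map_eq, hg]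
    rw [one_div_mul_eq_div, div_div, lt_div_iff₀ (by positivity), mul_comm (Real.log 2),
      ← mul_assoc]
  have hmeas : MeasurableSet (Y ⁻¹' {b | ε₀ * m * Real.log 2 < g b}) :=
    hYm (to_countable _).measurableSet
  rw [hset, ← measureReal_def, real_eq_sum_inter_fibre hYm ht hmeas]
  have hpt : ∀ b, ν.real (Y ⁻¹' {b}) * g b ≤ m * (ε₀ * Real.log 2 * ν.real (Y ⁻¹' {b}) +
      (Real.log 2 + Real.log (k + 2)) *
        ν.real (Y ⁻¹' {b | ε₀ * m * Real.log 2 < g b} ∩ Y ⁻¹' {b})) := by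
    intro b
    set w := ν.real (Y ⁻¹' {b}) with hw
    have hw0 : 0 ≤ w := measureReal_nonneg
    rcases hw0.eq_or_lt with h0 | hpos
    · rw [← h0]
      simp only [zero_mul, mul_zero, zero_add]
      positivity
    by_cases hb : ε₀ * m * Real.log 2 < g b
    · have hinter : Y ⁻¹' {b | ε₀ * m * Real.log 2 < g b} ∩ Y ⁻¹' {b} = Y ⁻¹' {b} := by
        refine inter_eq_right.2 ?_
        rintro q rfl
        exact hb
      rw [hinter, ← hw]
      have hne : ν (Y ⁻¹' {b}) ≠ 0 := by
        intro h
        simp [hw, measureReal_def, h] at hpos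
      have := ProbabilityTheory.cond_isProbabilityMeasure hne
      have hgb : g b ≤ m * Real.log 2 + Real.log (k + 2) :=
        fent_valIdx_le (P := ProbabilityTheory.cond ν (Y ⁻¹' {b}))
          (ProbabilityTheory.ae_cond_mem (hYm (measurableSet_singleton b))) m hx
      have h1 : g b ≤ m * (Real.log 2 + Real.log (k + 2)) := by nlinarith
      have h2 : 0 ≤ m * (ε₀ * Real.log 2 * w) := by positivity
      nlinarith [mul_le_mul_of_nonneg_left h1 hw0]
    · have h1 : w * g b ≤ w * (ε₀ * m * Real.log 2) :=
        mul_le_mul_of_nonneg_left (not_lt.1 hb) hw0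
      have h2 : 0 ≤ m * ((Real.log 2 + Real.log (k + 2)) *
          ν.real (Y ⁻¹' {b | ε₀ * m * Real.log 2 < g b} ∩ Y ⁻¹' {b})) := by positivity
      linarith
  refine (Finset.sum_le_sum fun b _ => hpt b).trans_eq ?_
  rw [← Finset.mul_sum, Finset.sum_add_distrib, ← Finset.mul_sum, ← Finset.mul_sum,
    sum_real_fibre hYm ht, mul_one]

lemma entV_sub_le_sum_highEntropyProportion [IsProbabilityMeasure ν]
    (hR : ∀ᵐ q ∂ν, ‖q‖ ≤ R) {x : Fin (k + 1) → ℝ} (hx : ∀ j, x j ∈ unitI)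
    {K : ℕ} (hK : ∀ (a : EuclideanSpace ℝ (Fin (k + 1))) (η : ℝ),
      (∀ j, |polyEval k a (x j)| ≤ η) → ‖a‖ ≤ K * η) {ε₀ : ℝ} (hε₀ : 0 ≤ ε₀) {m n : ℕ}
    (hm : 1 ≤ m) (hn : 1 ≤ n) :
    (1 / (n : ℝ)) * (entV (k + 1) n ν - entV (k + 1) m ν) ≤
      (k + 1) * ε₀ + (1 + Real.logb 2 (k + 2)) * ∑ j, highEntropyProportion k ν ε₀ m n (x j) +
        Real.logb 2 ((2 * K + 3) ^ (k + 1)) / m := by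
  have hlog2 : 0 < Real.log 2 := Real.log_pos (by norm_num)
  have hm0 : (0 : ℝ) < m := by exact_mod_cast hm
  have hn0 : (0 : ℝ) < n := by exact_mod_cast hn
  set L := Real.log ((2 * K + 3) ^ (k + 1) : ℝ) with hL
  set D := Real.log 2 + Real.log ((k : ℝ) + 2) with hD
  set F : ℕ → ℝ → ℝ := fun i y => (ν {q | ε₀ < (1 / (m : ℝ)) * ent1 (i + m)
    ((vcomp ν q i).map fun a => polyEval k a y)}).toReal with hF
  have hscale : ∀ i, fent ν (cellIdx (k + 1) (i + m)) - fent ν (cellIdx (k + 1) i) ≤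
      (∑ j, m * (ε₀ * Real.log 2 + D * F i (x j))) + L := by
    intro i
    rw [fent_cellIdx_add hR i m, add_sub_cancel_left]
    set Y := cellIdx (k + 1) i
    have hYm : Measurable Y := measurable_cellIdx _ _
    have ht : ∀ᵐ q ∂ν, Y q ∈ cellBox (k + 1) i R := hR.mono fun _ hq => cellIdx_mem_cellBox i hq
    have hb : ∀ b, ν.real (Y ⁻¹' {b}) *
          fent (ProbabilityTheory.cond ν (Y ⁻¹' {b})) (cellIdx (k + 1) (i + m)) ≤
        ∑ j, ν.real (Y ⁻¹' {b}) *
          fent (ProbabilityTheory.cond ν (Y ⁻¹' {b})) (valIdx k (i + m) (x j)) +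
          ν.real (Y ⁻¹' {b}) * L := by
      intro b
      rw [← Finset.mul_sum, ← mul_add]
      by_cases hne : ν (Y ⁻¹' {b}) = 0
      · simp [measureReal_def, hne]
      have := ProbabilityTheory.cond_isProbabilityMeasure hne
      exact mul_le_mul_of_nonneg_left
        (fent_cellIdx_le (ProbabilityTheory.cond_absolutelyContinuous.ae_le hR) hx hK _)
        measureReal_nonneg
    refine (Finset.sum_le_sum fun b _ => hb b).trans ?_
    rw [Finset.sum_add_distrib, ← Finset.sum_mul, sum_real_fibre hYm ht, one_mul,
      Finset.sum_comm]
    gcongr with j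
    exact sum_fent_cond_valIdx_le hR hε₀ hm i (hx j)
  have h1 := (mul_sub_le_sum_sub (monotone_fent_cellIdx hR) m n).trans
    (Finset.sum_le_sum fun i _ => hscale i)
  have h2 : ∑ i ∈ Finset.Icc 1 n, ((∑ j, m * (ε₀ * Real.log 2 + D * F i (x j))) + L) =
      n * m * Real.log 2 * ((k + 1) * ε₀ + D / Real.log 2 *
        ∑ j, highEntropyProportion k ν ε₀ m n (x j) + L / Real.log 2 / m) := by
    simp only [highEntropyProportion, ← Finset.mul_sum, Finset.sum_add_distrib, Finset.sum_const,
      Nat.card_Icc, nsmul_eq_mul, Finset.card_univ, Fintype.card_fin]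
    rw [Finset.sum_comm]
    simp only [hF]
    push_cast
    field_simp
  rw [h2] at h1
  have hD' : 1 + Real.logb 2 ((k : ℝ) + 2) = D / Real.log 2 := by
    rw [hD, Real.logb]
    field_simp
  rw [hD', entV_eq, entV_eq, Real.logb, ← hL, ← sub_div, one_div_mul_eq_div, div_div,
    div_le_iff₀ (by positivity)]
  refine le_of_mul_le_mul_left (h1.trans_eq ?_) hm0
  ring

lemma entV_le_logb_card [IsProbabilityMeasure ν] (hR : ∀ᵐ q ∂ν, ‖q‖ ≤ R) (m : ℕ) :
    entV (k + 1) m ν ≤ Real.logb 2 (cellBox (k + 1) m R).card := by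
  rw [entV_eq, Real.logb]
  gcongr
  exact fent_le_log_card (measurable_cellIdx _ _) (hR.mono fun _ hq => cellIdx_mem_cellBox m hq)

lemma measurable_highEntropyProportion [IsProbabilityMeasure ν] (hR : ∀ᵐ q ∂ν, ‖q‖ ≤ R)
    (ε₀ : ℝ) (m n : ℕ) : Measurable (highEntropyProportion k ν ε₀ m n) := by
  classical
  refine (Finset.measurable_sum _ fun i _ => ?_).const_mul _
  set Y := cellIdx (k + 1) i with hY
  have hYm : Measurable Y := measurable_cellIdx _ _
  have ht : ∀ᵐ q ∂ν, Y q ∈ cellBox (k + 1) i R := hR.mono fun _ hq => cellIdx_mem_cellBox i hq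
  set g : (Fin (k + 1) → ℤ) → ℝ → ℝ := fun b x => (1 / (m : ℝ)) * (fent
    (ProbabilityTheory.cond ν (Y ⁻¹' {b})) (valIdx k (i + m) x) / Real.log 2) with hg
  have hgm : ∀ b, Measurable (g b) := by
    intro b
    refine ((Measurable.tsum fun z => ?_).div_const _).const_mul _
    refine Real.continuous_negMulLog.measurable.comp (Measurable.ennreal_toReal ?_)
    have hs : MeasurableSet {w : ℝ × EuclideanSpace ℝ (Fin (k + 1)) |
        valIdx k (i + m) w.1 w.2 = z} :=
      (((continuous_polyEval k).measurable.mul_const _).floor) (measurableSet_singleton z)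
    exact measurable_measure_prodMk_left hs
  have hsum : (fun x => (ν {q | ε₀ < (1 / (m : ℝ)) * ent1 (i + m)
      ((vcomp ν q i).map fun a => polyEval k a x)}).toReal) =
      fun x => ∑ b ∈ cellBox (k + 1) i R, if ε₀ < g b x then ν.real (Y ⁻¹' {b}) else 0 := by
    ext x
    have hset : {q | ε₀ < (1 / (m : ℝ)) * ent1 (i + m)
        ((vcomp ν q i).map fun a => polyEval k a x)} = Y ⁻¹' {b | ε₀ < g b x} := by
      ext q
      simp only [mem_ofPred_eq, mem_preimage, vcomp_eq_cond, ent1_map_eq, hg, hY]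
    rw [hset, ← measureReal_def,
      real_eq_sum_inter_fibre hYm ht (hYm (to_countable _).measurableSet)]
    refine Finset.sum_congr rfl fun b _ => ?_
    split_ifs with hb
    · congr 1
      refine inter_eq_right.2 ?_
      rintro q rfl
      exact hb
    · have : Y ⁻¹' {b | ε₀ < g b x} ∩ Y ⁻¹' {b} = ∅ := by
        refine eq_empty_of_forall_notMem ?_
        rintro q ⟨h, rfl⟩
        exact hb h
      rw [this, measureReal_empty]
  rw [hsum]
  exact Finset.measurable_sum _ fun b _ =>
    Measurable.ite (measurableSet_lt measurable_const (hgm b)) measurable_const measurable_const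

lemma highEntropyProportion_nonneg (ε₀ : ℝ) (m n : ℕ) (x : ℝ) :
    0 ≤ highEntropyProportion k ν ε₀ m n x :=
  mul_nonneg (by positivity) (Finset.sum_nonneg fun _ _ => ENNReal.toReal_nonneg)

lemma integrable_highEntropyProportion [IsProbabilityMeasure ν] (hR : ∀ᵐ q ∂ν, ‖q‖ ≤ R)
    (ε₀ : ℝ) (m n : ℕ) (θ : Measure ℝ) [IsFiniteMeasure θ] :
    Integrable (highEntropyProportion k ν ε₀ m n) θ := by
  refine Integrable.of_bound (measurable_highEntropyProportion hR ε₀ m n).aestronglyMeasurable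
    ((1 / (n : ℝ)) * ∑ _i ∈ Finset.Icc 1 n, 1) (ae_of_all _ fun x => ?_)
  rw [Real.norm_of_nonneg (highEntropyProportion_nonneg ε₀ m n x)]
  unfold highEntropyProportion
  gcongr
  exact measureReal_le_one

lemma ae_norm_le_of_msupp {B : ℝ} (h : ∀ q ∈ msupp ν, ‖q‖ ≤ B) : ∀ᵐ q ∂ν, ‖q‖ ≤ B := by
  filter_upwards [Measure.support_mem_ae (μ := ν)] with q hq
  refine h q fun U hU hqU => ?_
  exact ((Measure.mem_support_iff_forall q).1 hq U (hU.mem_nhds hqU)).ne'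

end Multiscale

theorem entropy_of_nu_implies_entropy_of_pushforwards
    {Λ : Type} [Fintype Λ] [Nonempty Λ]
    (φ : Λ → ℝ → ℝ)
    (hanal : ∀ i, AnalyticOnNhd ℝ (φ i) unitI)
    (hmaps : ∀ i, Set.MapsTo (φ i) unitI unitI)
    (hderiv : ∀ i, ∀ x ∈ unitI, 0 < |deriv (φ i) x| ∧ |deriv (φ i) x| < 1)
    (hnofix : ¬ ∃ x ∈ unitI, ∀ i, φ i x = x)
    (p : Λ → ℝ) (hp : ∀ i, 0 < p i) (hp1 : ∑ i, p i = 1)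
    (μ : Measure ℝ) (hprob : IsProbabilityMeasure μ) (hμI : μ unitIᶜ = 0)
    (hμ : μ = ∑ i : Λ, ENNReal.ofReal (p i) • Measure.map (φ i) μ)
    :
    ∀ ε : ℝ, 0 < ε → ε < 1 → ∀ k : ℕ, 1 ≤ k →
      ∃ ε₀ : ℝ, 0 < ε₀ ∧ ∃ M : ℕ, 1 ≤ M ∧ ∀ m : ℕ, M ≤ m →
        ∃ N : ℕ, 1 ≤ N ∧ ∀ n : ℕ, N ≤ n →
          ∀ ν : Measure (EuclideanSpace ℝ (Fin (k + 1))), IsProbabilityMeasure ν →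
            (∃ S : Set (EuclideanSpace ℝ (Fin (k + 1))), IsCompact S ∧ ν Sᶜ = 0) →
            (∀ q ∈ msupp ν, ‖q‖ ≤ ε⁻¹) →
            ε ≤ (1 / (n : ℝ)) * entV (k + 1) n ν →
            ∀ ψ : ℝ → ℝ, ContDiffOn ℝ 1 ψ unitI → Set.MapsTo ψ unitI unitI →
              (∀ x ∈ unitI, ε ≤ |derivWithin ψ unitI x| ∧ |derivWithin ψ unitI x| ≤ ε⁻¹) →
              ε₀ < ∫ x, ((1 / (n : ℝ)) * ∑ i ∈ Finset.Icc 1 n,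
                (ν {q | ε₀ < (1 / (m : ℝ)) * ent1 (i + m)
                  ((vcomp ν q i).map fun a => polyEval k a x)}).toReal) ∂(μ.map ψ) := by
  intro ε hε hε1 k hk
  have hdiff : ∀ i, ∀ x ∈ unitI, DifferentiableAt ℝ (φ i) x :=
    fun i x hx => (hanal i x hx).differentiableAt
  obtain ⟨A, ρ, c, hρ, hc, hAI, hsep, hcA⟩ := exists_separated_sets hμI
    (infinite_support hp hμI hdiff hderiv hnofix hμ) k
  obtain ⟨K', hK'0, hK'⟩ := exists_norm_le_of_separated k (mul_pos hε hρ)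
  obtain ⟨K, hKK⟩ := exists_nat_ge K'
  have hlogk : 0 ≤ Real.logb 2 ((k : ℝ) + 2) :=
    Real.logb_nonneg (by norm_num) (by linarith [k.cast_nonneg (α := ℝ)])
  set D : ℝ := 1 + Real.logb 2 (k + 2)
  have hD : 0 < D := by positivity
  set C := Real.logb 2 ((2 * K + 3) ^ (k + 1) : ℝ)
  set c₂ : ℝ := ε / (8 * (D * (k + 1)))
  have hc₂ : 0 < c₂ := by positivity
  obtain ⟨ε₀, hε₀, hle₁, hle₂⟩ : ∃ ε₀ : ℝ, 0 < ε₀ ∧ (k + 1) * ε₀ ≤ ε / 8 ∧ ε₀ < c₂ * c := by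
    refine ⟨min (ε / 8 / (k + 1)) (c₂ * c / 2), by positivity, ?_, ?_⟩
    · rw [mul_comm, ← le_div_iff₀ (by positivity)]
      exact min_le_left _ _
    · exact (min_le_right _ _).trans_lt (half_lt_self (by positivity))
  obtain ⟨M, hM⟩ := exists_nat_ge (C / (ε / 8))
  refine ⟨ε₀, hε₀, max M 1, le_max_right _ _, fun m hm => ?_⟩
  have hm1 : 1 ≤ m := (le_max_right _ _).trans hm
  have hm0 : (0 : ℝ) < m := by exact_mod_cast hm1
  have hCm : C / m ≤ ε / 8 := by
    have h1 : (M : ℝ) ≤ m := by exact_mod_cast (le_max_left _ _).trans hm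
    have h2 := (div_le_iff₀ (by positivity)).1 (hM.trans h1)
    rw [div_le_iff₀ hm0]
    linarith
  set B := Real.logb 2 (cellBox (k + 1) m ε⁻¹).card
  obtain ⟨N, hN⟩ := exists_nat_ge (B / (ε / 2))
  refine ⟨max N 1, le_max_right _ _, fun n hn ν hν _ hsupp hent ψ hψ hψI hψ' => ?_⟩
  have hn1 : 1 ≤ n := (le_max_right _ _).trans hn
  have hn0 : (0 : ℝ) < n := by exact_mod_cast hn1
  have hBn : (1 / (n : ℝ)) * B ≤ ε / 2 := by
    have h1 : (N : ℝ) ≤ n := by exact_mod_cast (le_max_left _ _).trans hn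
    have h2 := (div_le_iff₀ (by positivity)).1 (hN.trans h1)
    rw [one_div_mul_eq_div, div_le_iff₀ hn0]
    linarith
  have hR := ae_norm_le_of_msupp hsupp
  have hψm : AEMeasurable ψ μ := aemeasurable_of_continuousOn_unitI hμI hψ.continuousOn
  have := Measure.isProbabilityMeasure_map hψm
  set f := highEntropyProportion k ν ε₀ m n
  obtain ⟨j, hj⟩ : ∃ j, ∀ y ∈ A j, c₂ ≤ f (ψ y) := by
    by_contra! hcon
    choose y hyA hyf using hcon
    have hyI := fun j => hAI j (hyA j)
    have hnorm : ∀ (a : EuclideanSpace ℝ (Fin (k + 1))) (η : ℝ),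
        (∀ j, |polyEval k a (ψ (y j))| ≤ η) → ‖a‖ ≤ K * η := by
      intro a η ha
      have hη : 0 ≤ η := (abs_nonneg _).trans (ha 0)
      refine (hK' (fun j => ψ (y j)) (fun j => hψI (hyI j)) (fun i j hij => ?_) a η ha).trans
        (by gcongr)
      obtain ⟨z, hz, h⟩ := exists_abs_sub_eq_of_hasDerivWithinAt
        (fun x hx => ((hψ.differentiableOn one_ne_zero) x hx).hasDerivWithinAt) (hyI i) (hyI j)
      rw [h]
      exact mul_le_mul (hψ' z hz).1 (hsep i j hij _ (hyA i) _ (hyA j)) hρ.le (abs_nonneg _)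
    have h1 := entV_sub_le_sum_highEntropyProportion hR (fun j => hψI (hyI j)) hnorm hε₀.le
      hm1 hn1
    have h2 : (1 / (n : ℝ)) * entV (k + 1) m ν ≤ ε / 2 :=
      (mul_le_mul_of_nonneg_left (entV_le_logb_card hR m) (by positivity)).trans hBn
    have h3 : D * ∑ j, f (ψ (y j)) ≤ D * ((k + 1) * c₂) := by
      gcongr
      refine (Finset.sum_le_sum fun j _ => (hyf j).le).trans_eq ?_
      simp
    have h4 : D * ((k + 1) * c₂) = ε / 8 := by
      simp only [c₂]
      field_simp
    rw [mul_sub] at h1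
    change _ ≤ _ + D * ∑ j, f (ψ (y j)) + C / m at h1
    linarith
  change ε₀ < ∫ x, f x ∂(μ.map ψ)
  calc ε₀ < c₂ * c := hle₂
    _ ≤ c₂ * (μ.map ψ).real {x | c₂ ≤ f x} := by
        gcongr
        calc c ≤ μ.real (A j) := hcA j
          _ ≤ μ.real (ψ ⁻¹' {x | c₂ ≤ f x}) := measureReal_mono hj
          _ ≤ _ := ENNReal.toReal_mono (measure_ne_top _ _) (Measure.le_map_apply hψm _)
    _ ≤ _ := mul_meas_ge_le_integral_of_nonneg
        (ae_of_all _ fun x => highEntropyProportion_nonneg ε₀ m n x)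
        (integrable_highEntropyProportion hR ε₀ m n _) c₂
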